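/- arXiv:2408.11694 — 4 statements merged into one kernel-verified Lean document; each statement's English description precedes it below -/
import Mathlib

section
/- Let G be an L⁰-convexly compact subset of L⁰(𝓕,B) that has random normal structure, and let 𝒯 be a family of surjective isometric mappings from G to G (no commutativity is assumed). Then 𝒯 has a common fixed point lying in the random Chebyshev center C(G,G): there exists x ∈ C(G,G) with T(x) = x for all T ∈ 𝒯. -/
open MeasureTheory Set Filter Function
open scoped Classical

noncomputable section

namespace RNM


variable {Ω : Type*} [MeasurableSpace Ω] {P : Measure Ω}
variable {B : Type*} [NormedAddCommGroup B] [NormedSpace ℝ B]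

/-- The pointwise norm of `x ∈ L⁰(𝓕,B)` as an element of `L⁰(𝓕,ℝ)`. -/
def nrm (x : Ω →ₘ[P] B) : Ω →ₘ[P] ℝ := x.comp norm continuous_norm

/-- The module action of `L⁰(𝓕,ℝ)` on `L⁰(𝓕,B)` (pointwise scalar multiplication). -/
def msmul (l : Ω →ₘ[P] ℝ) (x : Ω →ₘ[P] B) : Ω →ₘ[P] B :=
  AEEqFun.comp₂ (fun c (b : B) => c • b) continuous_smul l x

/-- `Ĩ_A`, the equivalence class of the indicator function of `A`, in `L⁰(𝓕,ℝ)`. -/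
def ind (A : Set Ω) (hA : MeasurableSet A) : Ω →ₘ[P] ℝ :=
  AEEqFun.mk (A.indicator fun _ => (1 : ℝ))
    ((measurable_const.indicator hA).aestronglyMeasurable)

/-- A subset of `L⁰(𝓕,B)` is a.s. bounded if the norms of its members have a common
bound in `L⁰(𝓕,ℝ)`. -/
def ASBounded (H : Set (Ω →ₘ[P] B)) : Prop :=
  ∃ ξ : Ω →ₘ[P] ℝ, ∀ h ∈ H, nrm h ≤ ξ

/-- The supremum of a subset of `L⁰(𝓕,ℝ)` (junk value `0` if no least upper bound exists;
for nonempty a.s. bounded-above sets the least upper bound always exists, by Dedekind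
completeness of `L⁰(𝓕,ℝ)`). -/
def lsup (S : Set (Ω →ₘ[P] ℝ)) : Ω →ₘ[P] ℝ :=
  if h : ∃ ξ, IsLUB S ξ then h.choose else 0

/-- The infimum of a subset of `L⁰(𝓕,ℝ)` (junk value `0` if no greatest lower bound exists). -/
def linf (S : Set (Ω →ₘ[P] ℝ)) : Ω →ₘ[P] ℝ :=
  if h : ∃ ξ, IsGLB S ξ then h.choose else 0

/-- The random Chebyshev radius `R(H,x)` of `H` at `x`. -/
def Rr (H : Set (Ω →ₘ[P] B)) (x : Ω →ₘ[P] B) : Ω →ₘ[P] ℝ :=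
  lsup ((fun y => nrm (x - y)) '' H)

/-- The random Chebyshev radius `R(H,G)` of `H` with respect to `G`. -/
def RrS (H G : Set (Ω →ₘ[P] B)) : Ω →ₘ[P] ℝ :=
  linf ((fun x => Rr H x) '' G)

/-- The random Chebyshev center `C(H,G)` of `H` with respect to `G`. -/
def Cc (H G : Set (Ω →ₘ[P] B)) : Set (Ω →ₘ[P] B) :=
  {x ∈ G | Rr H x = RrS H G}

/-- The random diameter `D(H)`. -/
def Dd (H : Set (Ω →ₘ[P] B)) : Ω →ₘ[P] ℝ :=
  lsup {ξ | ∃ x ∈ H, ∃ y ∈ H, ξ = nrm (x - y)}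

/-- A subset of `L⁰(𝓕,B)` is closed if it is sequentially closed under convergence in
probability (the `(ε,λ)`-topology). -/
def SeqClosed (S : Set (Ω →ₘ[P] B)) : Prop :=
  ∀ (x : ℕ → Ω →ₘ[P] B) (y : Ω →ₘ[P] B), (∀ n, x n ∈ S) →
    TendstoInMeasure P (fun n => (x n : Ω → B)) atTop y → y ∈ S

/-- The closure of a subset of `L⁰(𝓕,B)` under convergence in probability. -/
def seqClosure (S : Set (Ω →ₘ[P] B)) : Set (Ω →ₘ[P] B) :=
  {y | ∃ x : ℕ → Ω →ₘ[P] B, (∀ n, x n ∈ S) ∧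
    TendstoInMeasure P (fun n => (x n : Ω → B)) atTop y}

/-- `L⁰`-convexity. -/
def LConvex (G : Set (Ω →ₘ[P] B)) : Prop :=
  ∀ x ∈ G, ∀ y ∈ G, ∀ l : Ω →ₘ[P] ℝ, 0 ≤ l → l ≤ 1 →
    msmul l x + msmul (1 - l) y ∈ G

/-- `L⁰`-convex compactness: `G` is a nonempty closed `L⁰`-convex set such that every family
of nonempty closed `L⁰`-convex subsets of `G` with the finite intersection property has
nonempty intersection. -/
def ConvexlyCompact (G : Set (Ω →ₘ[P] B)) : Prop :=
  G.Nonempty ∧ SeqClosed G ∧ LConvex G ∧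
    ∀ 𝒞 : Set (Set (Ω →ₘ[P] B)),
      (∀ C ∈ 𝒞, C.Nonempty ∧ C ⊆ G ∧ SeqClosed C ∧ LConvex C) →
      (∀ S : Finset (Set (Ω →ₘ[P] B)), ↑S ⊆ 𝒞 → (⋂₀ (S : Set (Set (Ω →ₘ[P] B)))).Nonempty) →
      (⋂₀ 𝒞).Nonempty

/-- Random normal structure. -/
def RandNormalStructure (G : Set (Ω →ₘ[P] B)) : Prop :=
  ∀ H ⊆ G, H.Nonempty → ASBounded H → SeqClosed H → LConvex H → Dd H ≠ 0 →
    ∃ z ∈ H, ∀ᵐ ω ∂P, 0 < Dd H ω → Rr H z ω < Dd H ω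

/-- A nonexpansive mapping (on `G`). -/
def NonexpansiveOn (G : Set (Ω →ₘ[P] B)) (T : (Ω →ₘ[P] B) → (Ω →ₘ[P] B)) : Prop :=
  ∀ x ∈ G, ∀ y ∈ G, nrm (T x - T y) ≤ nrm (x - y)

/-- An isometric mapping (on `G`). -/
def IsometricOn (G : Set (Ω →ₘ[P] B)) (T : (Ω →ₘ[P] B) → (Ω →ₘ[P] B)) : Prop :=
  ∀ x ∈ G, ∀ y ∈ G, nrm (T x - T y) = nrm (x - y)

/-- A countable measurable partition of `Ω`. -/
def IsPartition (A : ℕ → Set Ω) : Prop :=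
  (∀ n, MeasurableSet (A n)) ∧ Pairwise (Disjoint on A) ∧ (⋃ n, A n) = univ

/-- `y` is the countable concatenation `Σ_n Ĩ_{A_n} x_n`,
i.e. `y` agrees a.s. with `x n` on `A n` for each `n`. -/
def IsConcat (A : ℕ → Set Ω) (x : ℕ → Ω →ₘ[P] B) (y : Ω →ₘ[P] B) : Prop :=
  ∀ n, ∀ᵐ ω ∂P, ω ∈ A n → y ω = x n ω

/-- `G` is σ-stable: it contains all countable concatenations of its members along
countable measurable partitions of `Ω`. -/
def SigmaStable (G : Set (Ω →ₘ[P] B)) : Prop :=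
  ∀ A : ℕ → Set Ω, IsPartition A → ∀ x : ℕ → Ω →ₘ[P] B, (∀ n, x n ∈ G) →
    ∀ y, IsConcat A x y → y ∈ G

/-- The σ-stable hull of `G`. -/
def sigmaHull (G : Set (Ω →ₘ[P] B)) : Set (Ω →ₘ[P] B) :=
  {y | ∃ A : ℕ → Set Ω, IsPartition A ∧
    ∃ x : ℕ → Ω →ₘ[P] B, (∀ n, x n ∈ G) ∧ IsConcat A x y}

/-- The countable concatenation `Σ_n Ĩ_{A_n} H_n` of a sequence of sets. -/
def concatSet (A : ℕ → Set Ω) (H : ℕ → Set (Ω →ₘ[P] B)) : Set (Ω →ₘ[P] B) :=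
  {y | ∃ x : ℕ → Ω →ₘ[P] B, (∀ n, x n ∈ H n) ∧ IsConcat A x y}

/-- A finitely stable subset of `L⁰(𝓕,B)`. -/
def FinStable (G : Set (Ω →ₘ[P] B)) : Prop :=
  ∀ x ∈ G, ∀ y ∈ G, ∀ A : Set Ω, ∀ hA : MeasurableSet A,
    msmul (ind A hA) x + msmul (ind Aᶜ hA.compl) y ∈ G


set_option linter.unusedSectionVars false

/-! ### Pointwise descriptions -/

lemma nrm_coe (x : Ω →ₘ[P] B) : ∀ᵐ ω ∂P, nrm x ω = ‖x ω‖ :=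
  AEEqFun.coeFn_comp norm continuous_norm x

lemma nrm_sub_coe (x y : Ω →ₘ[P] B) : ∀ᵐ ω ∂P, nrm (x - y) ω = ‖x ω - y ω‖ := by
  filter_upwards [nrm_coe (x - y), AEEqFun.coeFn_sub x y] with ω h1 h2
  rw [h1, h2, Pi.sub_apply]

lemma comb_coe (l : Ω →ₘ[P] ℝ) (x y : Ω →ₘ[P] B) :
    ∀ᵐ ω ∂P, (msmul l x + msmul (1 - l) y) ω = l ω • x ω + (1 - l ω) • y ω := by
  filter_upwards [AEEqFun.coeFn_add (msmul l x) (msmul (1 - l) y),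
    AEEqFun.coeFn_comp₂ (fun c (b : B) => c • b) continuous_smul l x,
    AEEqFun.coeFn_comp₂ (fun c (b : B) => c • b) continuous_smul (1 - l) y,
    AEEqFun.coeFn_sub 1 l, AEEqFun.coeFn_one (μ := P) (α := Ω) (β := ℝ)] with ω h1 h2 h3 h4 h5
  rw [h1, Pi.add_apply]
  unfold msmul
  rw [h2, h3, h4, Pi.sub_apply, h5, Pi.one_apply]

lemma glue {G : Set (Ω →ₘ[P] B)} (hG : LConvex G) {x y : Ω →ₘ[P] B} (hx : x ∈ G) (hy : y ∈ G)
    (A : Set Ω) (hA : MeasurableSet A) :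
    ∃ z ∈ G, ∀ᵐ ω ∂P, (ω ∈ A → z ω = x ω) ∧ (ω ∉ A → z ω = y ω) := by
  have hi : ∀ᵐ ω ∂P, (ind A hA : Ω →ₘ[P] ℝ) ω = A.indicator (fun _ => (1 : ℝ)) ω :=
    AEEqFun.coeFn_mk _ _
  refine ⟨_, hG x hx y hy (ind A hA) ?_ ?_, ?_⟩
  · rw [← AEEqFun.coeFn_le]
    filter_upwards [hi, AEEqFun.coeFn_zero (μ := P) (α := Ω) (β := ℝ)] with ω h1 h2
    rw [h1, h2]
    exact indicator_nonneg (fun _ _ => zero_le_one) ω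
  · rw [← AEEqFun.coeFn_le]
    filter_upwards [hi, AEEqFun.coeFn_one (μ := P) (α := Ω) (β := ℝ)] with ω h1 h2
    rw [h1, h2]
    by_cases h : ω ∈ A <;> simp [h]
  · filter_upwards [hi, comb_coe (ind A hA) x y] with ω h1 h2
    rw [h2, h1]
    constructor
    · intro h; simp [h]
    · intro h; simp [h]

lemma tim_ae {x : ℕ → Ω →ₘ[P] B} {y : Ω →ₘ[P] B}
    (h : TendstoInMeasure P (fun n => (x n : Ω → B)) atTop y) :
    ∃ ns : ℕ → ℕ, ∀ᵐ ω ∂P, Tendsto (fun i => x (ns i) ω) atTop (nhds (y ω)) := by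
  obtain ⟨ns, _, hns⟩ := h.exists_seq_tendsto_ae
  exact ⟨ns, hns⟩

/-- Sets described by a pointwise closed convex condition. -/
lemma pw_closed {G : Set (Ω →ₘ[P] B)} (hG : SeqClosed G) (φ : Ω → B → Prop)
    (hφ : ∀ ω, IsClosed {b | φ ω b}) : SeqClosed {x ∈ G | ∀ᵐ ω ∂P, φ ω (x ω)} := by
  intro x y hx hxy
  refine ⟨hG x y (fun n => (hx n).1) hxy, ?_⟩
  obtain ⟨ns, hns⟩ := tim_ae hxy
  have : ∀ᵐ ω ∂P, ∀ n, φ ω (x n ω) := ae_all_iff.2 fun n => (hx n).2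
  filter_upwards [hns, this] with ω h1 h2
  exact (hφ ω).mem_of_tendsto h1 (Eventually.of_forall fun i => h2 (ns i))

lemma pw_convex {G : Set (Ω →ₘ[P] B)} (hG : LConvex G) (φ : Ω → B → Prop)
    (hφ : ∀ ω, Convex ℝ {b | φ ω b}) : LConvex {x ∈ G | ∀ᵐ ω ∂P, φ ω (x ω)} := by
  intro x hx y hy l h0 h1
  refine ⟨hG x hx.1 y hy.1 l h0 h1, ?_⟩
  rw [← AEEqFun.coeFn_le] at h0 h1
  filter_upwards [h0, h1, hx.2, hy.2, comb_coe l x y,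
    AEEqFun.coeFn_zero (μ := P) (α := Ω) (β := ℝ),
    AEEqFun.coeFn_one (μ := P) (α := Ω) (β := ℝ)] with ω a0 a1 a2 a3 a4 a5 a6
  rw [a4]
  rw [a5] at a0
  rw [a6] at a1
  exact hφ ω a2 a3 a0 (sub_nonneg.2 a1) (by simp)

/-! ### Essential suprema -/

lemma ess_sets [IsFiniteMeasure P] {ι : Type*} [Nonempty ι] (s : ι → Set Ω)
    (hs : ∀ i, MeasurableSet (s i)) :
    ∃ u : ℕ → ι, ∀ i, ∀ᵐ ω ∂P, ω ∈ s i → ∃ n, ω ∈ s (u n) := by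
  let F : (ℕ → ι) → ENNReal := fun u => P (⋃ n, s (u n))
  let m := ⨆ u, F u
  have hm : m ≠ ⊤ := by
    refine ne_top_of_le_ne_top (measure_ne_top P univ) ?_
    exact iSup_le fun u => measure_mono (subset_univ _)
  have hex : ∀ k : ℕ, ∃ u, m - (k + 1 : ENNReal)⁻¹ ≤ F u := by
    intro k
    by_contra! h
    have h1 : m ≤ m - (k + 1 : ENNReal)⁻¹ := iSup_le fun u => (h u).le
    rcases eq_or_ne m 0 with h0 | h0
    · have := h (fun _ => Classical.arbitrary ι)
      rw [h0] at this
      simp at this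
    · exact absurd h1 (not_le.2 (ENNReal.sub_lt_self hm h0 (by simp)))
  choose v hv using hex
  let e := Denumerable.eqv (ℕ × ℕ)
  let w : ℕ → ι := fun n => v (e.symm n).1 (e.symm n).2
  have hw : m ≤ F w := by
    have h1 : ∀ k : ℕ, m - (k + 1 : ENNReal)⁻¹ ≤ F w := fun k => (hv k).trans <| by
      refine measure_mono (iUnion_subset fun n => ?_)
      refine subset_iUnion_of_subset (e (k, n)) ?_
      simp [w]
    refine ENNReal.le_of_forall_pos_le_add fun ε hε _ => ?_
    obtain ⟨k, hk⟩ := ENNReal.exists_inv_nat_lt (a := (ε : ENNReal)) (by simpa using hε.ne')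
    have h2 : ((k : ENNReal) + 1)⁻¹ ≤ ε := le_trans (ENNReal.inv_le_inv.2 (by simp)) hk.le
    have := tsub_le_iff_right.1 (h1 k)
    exact this.trans (by gcongr)
  refine ⟨w, fun i => ?_⟩
  have hsub : P ((⋃ n, s (w n)) ∪ s i) ≤ P (⋃ n, s (w n)) := by
    refine le_trans ?_ hw
    refine le_trans ?_ (le_iSup F (fun n => Nat.casesOn n i w))
    refine measure_mono (union_subset (iUnion_subset fun n => ?_) ?_)
    · exact subset_iUnion_of_subset (n + 1) subset_rfl
    · exact subset_iUnion_of_subset 0 subset_rfl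
  have := ae_eq_of_subset_of_measure_ge subset_union_left hsub
    (MeasurableSet.iUnion fun n => hs (w n)).nullMeasurableSet (measure_ne_top P _)
  filter_upwards [this.mem_iff] with ω h1 h2
  simpa using h1.2 (Or.inr h2)

lemma ess_fun [IsFiniteMeasure P] {ι : Type*} [Nonempty ι] (f : ι → Ω → ℝ)
    (hf : ∀ i, Measurable (f i)) :
    ∃ u : ℕ → ι, ∀ i, ∀ᵐ ω ∂P, ∀ q : ℚ, (q : ℝ) < f i ω → ∃ n, (q : ℝ) < f (u n) ω := by
  have := fun q : ℚ => ess_sets (P := P) (fun i => {ω | (q : ℝ) < f i ω})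
    (fun i => measurableSet_lt measurable_const (hf i))
  choose u hu using this
  refine ⟨fun n => u ((Denumerable.eqv (ℚ × ℕ)).symm n).1 ((Denumerable.eqv (ℚ × ℕ)).symm n).2, fun i => ?_⟩
  have := ae_all_iff.2 fun q => hu q i
  filter_upwards [this] with ω h q hq
  obtain ⟨n, hn⟩ := h q hq
  exact ⟨Denumerable.eqv (ℚ × ℕ) (q, n), by simpa using hn⟩

lemma exists_lub [IsFiniteMeasure P] (S : Set (Ω →ₘ[P] ℝ)) (hne : S.Nonempty) (hb : BddAbove S) :
    ∃ ξ, IsLUB S ξ := by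
  have : Nonempty S := hne.to_subtype
  obtain ⟨b, hb⟩ := hb
  obtain ⟨u, hu⟩ := ess_fun (P := P) (fun i : S => (i.1 : Ω → ℝ))
    (fun i => i.1.measurable)
  have hbd : ∀ c ∈ upperBounds S, ∀ᵐ ω ∂P, ∀ n, (u n).1 ω ≤ c ω := fun c hc =>
    ae_all_iff.2 fun n => AEEqFun.coeFn_le.2 (hc (u n).2)
  have hmeas : Measurable (fun ω => ⨆ n, (u n).1 ω) :=
    Measurable.iSup fun n => (u n).1.measurable
  have hc : ∀ᵐ ω ∂P, AEEqFun.mk (μ := P) _ hmeas.aestronglyMeasurable ω = ⨆ n, (u n).1 ω :=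
    AEEqFun.coeFn_mk _ _
  refine ⟨AEEqFun.mk _ hmeas.aestronglyMeasurable, ?_, ?_⟩
  · intro f hf
    rw [← AEEqFun.coeFn_le]
    filter_upwards [hc, hu ⟨f, hf⟩, hbd b hb] with ω h1 h2 h3
    rw [h1]
    by_contra! h
    obtain ⟨q, hq1, hq2⟩ := exists_rat_btwn h
    obtain ⟨n, hn⟩ := h2 q hq2
    have : (u n).1 ω ≤ ⨆ n, (u n).1 ω := le_ciSup ⟨b ω, by rintro _ ⟨n, rfl⟩; exact h3 n⟩ n
    linarith
  · intro c hc'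
    rw [← AEEqFun.coeFn_le]
    filter_upwards [hc, hbd c hc'] with ω h1 h2
    rw [h1]
    exact ciSup_le h2

lemma lsup_isLUB [IsFiniteMeasure P] (S : Set (Ω →ₘ[P] ℝ)) (hne : S.Nonempty) (hb : BddAbove S) :
    IsLUB S (lsup S) := by
  have h := exists_lub S hne hb
  unfold lsup
  rw [dif_pos h]
  exact h.choose_spec

/-! ### Random norming functionals and the gliding hump -/

lemma sm_apply {f : Ω → StrongDual ℝ B} {x : Ω → B} (hf : StronglyMeasurable f)
    (hx : StronglyMeasurable x) : StronglyMeasurable fun ω => f ω (x ω) :=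
  isBoundedBilinearMap_apply.continuous.comp_stronglyMeasurable (hf.prodMk hx)

lemma norming (x : Ω → B) (hx : StronglyMeasurable x) :
    ∃ g : Ω → StrongDual ℝ B, StronglyMeasurable g ∧ (∀ ω, ‖g ω‖ ≤ 1) ∧
      ∀ ω, 3 / 4 * ‖x ω‖ ≤ g ω (x ω) := by
  have h := fun b : B => exists_dual_vector'' ℝ b
  choose h h1 h2 using h
  let p : ℕ → Ω → Prop := fun n ω => ‖hx.approx n ω - x ω‖ ≤ ‖x ω‖ / 8 ∨ ‖x ω‖ = 0
  have hp : ∀ ω, ∃ n, p n ω := by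
    intro ω
    by_cases h0 : ‖x ω‖ = 0
    · exact ⟨0, Or.inr h0⟩
    · have := (tendsto_iff_norm_sub_tendsto_zero.1 (hx.tendsto_approx ω)).eventually
        (ge_mem_nhds (show (0 : ℝ) < ‖x ω‖ / 8 by positivity))
      obtain ⟨n, hn⟩ := this.exists
      exact ⟨n, Or.inl hn⟩
  have hpm : ∀ n, MeasurableSet {ω | p n ω} := by
    intro n
    have e1 : Measurable fun ω => ‖hx.approx n ω - x ω‖ :=
      ((hx.approx n).stronglyMeasurable.sub hx).norm.measurable
    have e2 : Measurable fun ω => ‖x ω‖ := hx.norm.measurable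
    exact (measurableSet_le e1 (e2.div_const 8)).union (measurableSet_eq_fun e2 measurable_const)
  refine ⟨fun ω => h (hx.approx (Nat.find (hp ω)) ω), ?_, fun ω => h1 _, fun ω => ?_⟩
  · borelize (StrongDual ℝ B)
    rw [stronglyMeasurable_iff_measurable_separable]
    constructor
    · exact Measurable.find (f := fun n ω => h (hx.approx n ω))
        (fun n => ((hx.approx n).map h).measurable) hpm hp
    · have : (⋃ n, range (fun ω => h (hx.approx n ω))).Countable :=
        countable_iUnion fun n => ((hx.approx n).map h).finite_range.countable
      refine this.isSeparable.mono ?_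
      rintro _ ⟨ω, rfl⟩
      exact mem_iUnion.2 ⟨Nat.find (hp ω), ω, rfl⟩
  · have hn := Nat.find_spec (hp ω)
    set s := hx.approx (Nat.find (hp ω)) ω
    rcases hn with hn | hn
    · have a1 : h s (s - x ω) ≤ ‖s - x ω‖ := by
        refine (le_abs_self _).trans (((h s).le_opNorm _).trans ?_)
        exact mul_le_of_le_one_left (norm_nonneg _) (h1 s)
      rw [map_sub, h2 s] at a1
      simp only [RCLike.ofReal_real_eq_id, id] at a1
      have a2 : ‖x ω‖ ≤ ‖s‖ + ‖s - x ω‖ := by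
        have := norm_sub_le s (s - x ω)
        simpa using this
      change ‖s - x ω‖ ≤ _ at hn
      linarith
    · rw [hn, norm_eq_zero.1 hn]; simp

lemma gliding (x : ℕ → Ω → B) (hx : ∀ n, StronglyMeasurable (x n)) :
    ∃ f : Ω → StrongDual ℝ B, StronglyMeasurable f ∧
      ∀ ω n, 1 / 4 * (1 / 3 : ℝ) ^ n * ‖x n ω‖ ≤ |f ω (x n ω)| := by
  choose g gm g1 g2 using fun n => norming (x n) (hx n)
  let F : ℕ → Ω → StrongDual ℝ B := fun n => Nat.rec (fun _ => 0)
    (fun n f ω => f ω + (if 0 ≤ f ω (x n ω) then (1 / 3 : ℝ) ^ n else - (1 / 3 : ℝ) ^ n) • g n ω) n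
  have Fs : ∀ n ω, F (n + 1) ω = F n ω +
    (if 0 ≤ F n ω (x n ω) then (1 / 3 : ℝ) ^ n else - (1 / 3 : ℝ) ^ n) • g n ω := fun n ω => rfl
  have Fm : ∀ n, StronglyMeasurable (F n) := by
    intro n
    induction n with
    | zero => exact stronglyMeasurable_const
    | succ n ih =>
      have : F (n + 1) = fun ω => F n ω +
        (if 0 ≤ F n ω (x n ω) then (1 / 3 : ℝ) ^ n else - (1 / 3 : ℝ) ^ n) • g n ω :=
        funext fun ω => Fs n ω
      rw [this]
      have hsg : StronglyMeasurable fun ω =>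
          (if 0 ≤ F n ω (x n ω) then (1 / 3 : ℝ) ^ n else - (1 / 3 : ℝ) ^ n) :=
        StronglyMeasurable.ite
          (measurableSet_le measurable_const (sm_apply ih (hx n)).measurable)
          stronglyMeasurable_const stronglyMeasurable_const
      exact ih.add (hsg.smul (gm n))
  have hd : ∀ ω n, dist (F n ω) (F (n + 1) ω) ≤ 1 * (1 / 3 : ℝ) ^ n := by
    intro ω n
    rw [Fs, dist_self_add_right, norm_smul]
    have : ‖(if 0 ≤ F n ω (x n ω) then (1 / 3 : ℝ) ^ n else - (1 / 3 : ℝ) ^ n)‖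
        = (1 / 3 : ℝ) ^ n := by
      split_ifs <;> simp
    rw [this, one_mul]
    exact mul_le_of_le_one_right (by positivity) (g1 n ω)
  have hlim : ∀ ω, ∃ f, Tendsto (fun n => F n ω) atTop (nhds f) := fun ω =>
    cauchySeq_tendsto_of_complete (cauchySeq_of_le_geometric (1 / 3) 1 (by norm_num) (hd ω))
  choose f hf using hlim
  refine ⟨f, stronglyMeasurable_of_tendsto atTop Fm (tendsto_pi_nhds.2 hf), fun ω n => ?_⟩
  have b1 := dist_le_of_le_geometric_of_tendsto (1 / 3) 1 (by norm_num) (hd ω) (hf ω) (n + 1)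
  have b2 : |F (n + 1) ω (x n ω) - f ω (x n ω)| ≤ 1 / 2 * (1 / 3 : ℝ) ^ n * ‖x n ω‖ := by
    rw [← _root_.sub_apply]
    refine ((F (n + 1) ω - f ω).le_opNorm _).trans ?_
    gcongr
    rw [← dist_eq_norm]
    refine b1.trans (le_of_eq ?_)
    rw [pow_succ]; ring
  have b3 : 3 / 4 * (1 / 3 : ℝ) ^ n * ‖x n ω‖ ≤ |F (n + 1) ω (x n ω)| := by
    have hp : (0 : ℝ) ≤ (1 / 3 : ℝ) ^ n := by positivity
    have := mul_le_mul_of_nonneg_left (g2 n ω) hp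
    rw [Fs]
    split_ifs with h
    · refine le_trans ?_ (le_abs_self _)
      simp only [_root_.add_apply, _root_.smul_apply, smul_eq_mul]
      linarith
    · refine le_trans ?_ (neg_le_abs _)
      simp only [_root_.add_apply, _root_.smul_apply, smul_eq_mul]
      linarith
  have b4 := abs_sub_abs_le_abs_sub (F (n + 1) ω (x n ω)) (f ω (x n ω))
  linarith

/-! ### Boundedness of convexly compact sets -/

lemma runmax {G : Set (Ω →ₘ[P] B)} (hG : LConvex G) (φ : Ω → B → ℝ)
    (hφ : ∀ x : Ω →ₘ[P] B, Measurable fun ω => φ ω (x ω)) (x : ℕ → Ω →ₘ[P] B)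
    (hx : ∀ n, x n ∈ G) :
    ∃ y : ℕ → Ω →ₘ[P] B, (∀ n, y n ∈ G) ∧ ∀ᵐ ω ∂P,
      (∀ n, φ ω (x n ω) ≤ φ ω (y n ω)) ∧ Monotone fun n => φ ω (y n ω) := by
  have key : ∀ a b : Ω →ₘ[P] B, ∃ z, a ∈ G → b ∈ G → (z ∈ G ∧ ∀ᵐ ω ∂P,
      φ ω (a ω) ≤ φ ω (z ω) ∧ φ ω (b ω) ≤ φ ω (z ω)) := by
    intro a b
    by_cases ha : a ∈ G
    swap
    · exact ⟨a, fun h => absurd h ha⟩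
    by_cases hb : b ∈ G
    swap
    · exact ⟨a, fun _ h => absurd h hb⟩
    obtain ⟨z, hz, h⟩ := glue hG ha hb {ω | φ ω (b ω) ≤ φ ω (a ω)} (measurableSet_le (hφ b) (hφ a))
    refine ⟨z, fun _ _ => ⟨hz, ?_⟩⟩
    filter_upwards [h] with ω hω
    by_cases hh : φ ω (b ω) ≤ φ ω (a ω)
    · rw [hω.1 hh]; exact ⟨le_rfl, hh⟩
    · rw [hω.2 hh]; exact ⟨(not_le.1 hh).le, le_rfl⟩
  choose Z hZ using key
  let y : ℕ → Ω →ₘ[P] B := fun n => Nat.rec (x 0) (fun n a => Z a (x (n + 1))) n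
  have ys : ∀ n, y (n + 1) = Z (y n) (x (n + 1)) := fun n => rfl
  have yG : ∀ n, y n ∈ G := by
    intro n
    induction n with
    | zero => exact hx 0
    | succ n ih => rw [ys]; exact (hZ _ _ ih (hx _)).1
  refine ⟨y, yG, ?_⟩
  have := ae_all_iff.2 fun n => (hZ _ _ (yG n) (hx (n + 1))).2
  filter_upwards [this] with ω h
  constructor
  · intro n
    cases n with
    | zero => exact le_rfl
    | succ n => rw [ys]; exact (h n).2
  · exact monotone_nat_of_le_succ fun n => by rw [ys]; exact (h n).1

lemma fip_seq {G : Set (Ω →ₘ[P] B)} (hG : ConvexlyCompact G) (C : ℕ → Set (Ω →ₘ[P] B))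
    (hC : ∀ n, (C n).Nonempty ∧ C n ⊆ G ∧ SeqClosed (C n) ∧ LConvex (C n)) (hm : Antitone C) :
    ∃ x ∈ G, ∀ n, x ∈ C n := by
  obtain ⟨x, hx⟩ := hG.2.2.2 (range C) (by rintro _ ⟨n, rfl⟩; exact hC n) (by
    intro S hS
    have : ∃ N, ∀ s ∈ S, C N ⊆ s := by
      induction S using Finset.induction_on with
      | empty => exact ⟨0, by simp⟩
      | insert a S ha ih =>
        rw [Finset.coe_insert, insert_subset_iff] at hS
        obtain ⟨N, hN⟩ := ih hS.2
        obtain ⟨k, rfl⟩ := hS.1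
        refine ⟨max N k, fun s hs => ?_⟩
        rcases Finset.mem_insert.1 hs with rfl | hs
        · exact hm (le_max_right _ _)
        · exact (hm (le_max_left _ _)).trans (hN s hs)
    obtain ⟨N, hN⟩ := this
    obtain ⟨x, hx⟩ := (hC N).1
    exact ⟨x, fun s hs => hN s hs hx⟩)
  have hx' : ∀ n, x ∈ C n := fun n => hx _ ⟨n, rfl⟩
  exact ⟨x, (hC 0).2.1 (hx' 0), hx'⟩

lemma lin_bdd {G : Set (Ω →ₘ[P] B)} (hG : ConvexlyCompact G) (f : Ω → StrongDual ℝ B)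
    (hf : StronglyMeasurable f) (x : ℕ → Ω →ₘ[P] B) (hx : ∀ n, x n ∈ G) :
    ∃ z : Ω →ₘ[P] B, ∀ᵐ ω ∂P, ∀ n, f ω (x n ω) ≤ f ω (z ω) := by
  obtain ⟨y, yG, hy⟩ := runmax hG.2.2.1 (fun ω b => f ω b)
    (fun x => (sm_apply hf x.stronglyMeasurable).measurable) x hx
  obtain ⟨z, -, hz⟩ := fip_seq hG
    (fun n => {z ∈ G | ∀ᵐ ω ∂P, f ω (y n ω) ≤ f ω (z ω)}) (by
      intro n
      refine ⟨⟨y n, yG n, ae_of_all _ fun _ => le_rfl⟩, fun z hz => hz.1, ?_, ?_⟩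
      · exact pw_closed hG.2.1 (fun ω b => f ω (y n ω) ≤ f ω b)
          (fun ω => isClosed_le continuous_const (f ω).continuous)
      · exact pw_convex hG.2.2.1 (fun ω b => f ω (y n ω) ≤ f ω b)
          (fun ω => convex_halfSpace_ge (f ω).isLinear _)) (by
      intro n m hnm z hz
      refine ⟨hz.1, ?_⟩
      filter_upwards [hz.2, hy] with ω h1 h2
      exact (h2.2 hnm).trans h1)
  refine ⟨z, ?_⟩
  filter_upwards [hy, ae_all_iff.2 fun n => (hz n).2] with ω h1 h2 n
  exact (h1.1 n).trans (h2 n)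

lemma compact_bdd [IsFiniteMeasure P] {G : Set (Ω →ₘ[P] B)} (hG : ConvexlyCompact G) :
    ASBounded G := by
  have : Nonempty G := hG.1.to_subtype
  obtain ⟨u, hu⟩ := ess_fun (P := P) (fun (i : G) ω => ‖i.1 ω‖)
    (fun i => i.1.stronglyMeasurable.norm.measurable)
  obtain ⟨y, yG, hy⟩ := runmax hG.2.2.1 (fun _ b => ‖b‖)
    (fun x => x.stronglyMeasurable.norm.measurable) (fun n => (u n).1) (fun n => (u n).2)
  have ym : ∀ n, Measurable fun ω => ‖y n ω‖ := fun n => (y n).stronglyMeasurable.norm.measurable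
  have hbd : ∀ᵐ ω ∂P, BddAbove (range fun n => ‖y n ω‖) := by
    let A := {ω | ¬ BddAbove (range fun n => ‖y n ω‖)}
    have hA : MeasurableSet A := (measurableSet_bddAbove_range ym).compl
    -- choose a fast subsequence
    have hsub : ∀ k : ℕ, ∃ m, P (A ∩ {ω | ‖y m ω‖ < 4 ^ k}) ≤ (1 / 2 : ENNReal) ^ k := by
      intro k
      let s : ℕ → Set Ω := fun m => ⋂ j ≤ m, (A ∩ {ω | ‖y j ω‖ < 4 ^ k})
      have hs : ∀ m, MeasurableSet (s m) := fun m =>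
        MeasurableSet.iInter fun j => MeasurableSet.iInter fun _ =>
          hA.inter (measurableSet_lt (ym j) measurable_const)
      have ht := tendsto_measure_iInter_atTop (μ := P) (s := s)
        (fun m => (hs m).nullMeasurableSet) (fun a b hab => by
          exact biInter_subset_biInter_left fun j hj => le_trans hj hab) ⟨0, measure_ne_top _ _⟩
      have he : ⋂ m, s m = ∅ := by
        rw [eq_empty_iff_forall_notMem]
        intro ω hω
        have h1 : ∀ m, ω ∈ A ∩ {ω | ‖y m ω‖ < 4 ^ k} := fun m =>
          mem_iInter₂.1 (mem_iInter.1 hω m) m le_rfl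
        exact (h1 0).1 ⟨4 ^ k, by rintro _ ⟨m, rfl⟩; exact (h1 m).2.le⟩
      rw [he, measure_empty] at ht
      obtain ⟨m, hm⟩ := (ht.eventually (ge_mem_nhds (show (0 : ENNReal) < (1 / 2) ^ k by
        exact pos_iff_ne_zero.2 (pow_ne_zero _ (by simp))))).exists
      refine ⟨m, le_trans (measure_mono_ae ?_) hm⟩
      filter_upwards [hy] with ω h1 h2
      refine mem_iInter₂.2 fun j hj => ⟨h2.1, ?_⟩
      exact lt_of_le_of_lt (h1.2 hj) h2.2
    choose m hm using hsub
    obtain ⟨f, hf, hfx⟩ := gliding (fun k => (y (m k) : Ω → B))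
      (fun k => (y (m k)).stronglyMeasurable)
    obtain ⟨z1, hz1⟩ := lin_bdd hG f hf (fun k => y (m k)) (fun k => yG _)
    obtain ⟨z2, hz2⟩ := lin_bdd hG (fun ω => - f ω) hf.neg (fun k => y (m k)) (fun k => yG _)
    have hbc := ae_eventually_notMem (μ := P) (s := fun k => A ∩ {ω | ‖y (m k) ω‖ < 4 ^ k}) (by
      refine ne_top_of_le_ne_top ?_ (ENNReal.tsum_le_tsum hm)
      rw [ENNReal.tsum_geometric]
      simp)
    filter_upwards [hz1, hz2, hbc] with ω h1 h2 h3
    by_contra hω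
    let c := max (f ω (z1 ω)) (- f ω (z2 ω))
    have hc : ∀ k, |f ω (y (m k) ω)| ≤ c := fun k =>
      abs_le'.2 ⟨(h1 k).trans (le_max_left _ _), (h2 k).trans (le_max_right _ _)⟩
    have ht : Tendsto (fun k : ℕ => 1 / 4 * (4 / 3 : ℝ) ^ k) atTop atTop :=
      (tendsto_pow_atTop_atTop_of_one_lt (by norm_num)).const_mul_atTop (by norm_num)
    obtain ⟨k, hk1, hk2⟩ := (h3.and (ht.eventually_gt_atTop c)).exists
    have hk3 : (4 : ℝ) ^ k ≤ ‖y (m k) ω‖ := by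
      by_contra! hlt
      exact hk1 ⟨hω, hlt⟩
    have h5 := hfx ω k
    have h6 : 1 / 4 * (4 / 3 : ℝ) ^ k ≤ 1 / 4 * (1 / 3 : ℝ) ^ k * ‖y (m k) ω‖ := by
      have : (4 / 3 : ℝ) ^ k = (1 / 3) ^ k * 4 ^ k := by rw [← mul_pow]; norm_num
      rw [this, ← mul_assoc]
      gcongr
    linarith [hc k]
  have hmeas : Measurable (fun ω => ⨆ n, ‖y n ω‖) := Measurable.iSup ym
  have hc : ∀ᵐ ω ∂P, AEEqFun.mk (μ := P) _ hmeas.aestronglyMeasurable ω = ⨆ n, ‖y n ω‖ :=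
    AEEqFun.coeFn_mk _ _
  refine ⟨AEEqFun.mk _ hmeas.aestronglyMeasurable, fun x hx => ?_⟩
  rw [← AEEqFun.coeFn_le]
  filter_upwards [hc, hu ⟨x, hx⟩, hbd, hy, nrm_coe x] with ω h1 h2 h3 h4 h5
  rw [h1, h5]
  by_contra! h
  obtain ⟨q, hq1, hq2⟩ := exists_rat_btwn h
  obtain ⟨n, hn⟩ := h2 q hq2
  have := le_ciSup h3 n
  have := h4.1 n
  linarith

/-! ### Random Chebyshev centers -/

lemma sub_compact {G K : Set (Ω →ₘ[P] B)} (hG : ConvexlyCompact G) (hK : K ⊆ G)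
    (h0 : K.Nonempty) (h1 : SeqClosed K) (h2 : LConvex K) : ConvexlyCompact K :=
  ⟨h0, h1, h2, fun 𝒞 hC hf => hG.2.2.2 𝒞
    (fun C hc => ⟨(hC C hc).1, (hC C hc).2.1.trans hK, (hC C hc).2.2⟩) hf⟩

lemma nrm_sub_le_add {x y : Ω →ₘ[P] B} {ξ : Ω →ₘ[P] ℝ} (hx : nrm x ≤ ξ) (hy : nrm y ≤ ξ) :
    nrm (x - y) ≤ ξ + ξ := by
  rw [← AEEqFun.coeFn_le] at *
  filter_upwards [hx, hy, nrm_coe x, nrm_coe y, nrm_sub_coe x y, AEEqFun.coeFn_add ξ ξ]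
    with ω h1 h2 h3 h4 h5 h6
  rw [h5, h6, Pi.add_apply]
  rw [h3] at h1
  rw [h4] at h2
  exact (norm_sub_le _ _).trans (add_le_add h1 h2)

lemma Rr_lub [IsFiniteMeasure P] {K : Set (Ω →ₘ[P] B)} (h0 : K.Nonempty) (hb : ASBounded K)
    {x : Ω →ₘ[P] B} (hx : x ∈ K) : IsLUB ((fun y => nrm (x - y)) '' K) (Rr K x) := by
  obtain ⟨ξ, hξ⟩ := hb
  refine lsup_isLUB _ (h0.image _) ⟨ξ + ξ, ?_⟩
  rintro _ ⟨y, hy, rfl⟩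
  exact nrm_sub_le_add (hξ x hx) (hξ y hy)

lemma Dd_lub [IsFiniteMeasure P] {K : Set (Ω →ₘ[P] B)} (h0 : K.Nonempty) (hb : ASBounded K) :
    IsLUB {ξ | ∃ x ∈ K, ∃ y ∈ K, ξ = nrm (x - y)} (Dd K) := by
  obtain ⟨ξ, hξ⟩ := hb
  obtain ⟨a, ha⟩ := h0
  refine lsup_isLUB _ ⟨_, a, ha, a, ha, rfl⟩ ⟨ξ + ξ, ?_⟩
  rintro _ ⟨x, hx, y, hy, rfl⟩
  exact nrm_sub_le_add (hξ x hx) (hξ y hy)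

lemma Rr_le_iff [IsFiniteMeasure P] {K : Set (Ω →ₘ[P] B)} (h0 : K.Nonempty) (hb : ASBounded K)
    {x : Ω →ₘ[P] B} (hx : x ∈ K) (ξ : Ω →ₘ[P] ℝ) :
    Rr K x ≤ ξ ↔ ∀ y ∈ K, nrm (x - y) ≤ ξ := by
  rw [isLUB_le_iff (Rr_lub h0 hb hx)]
  simp [upperBounds]

/-- Closedness and convexity of level sets of the random Chebyshev radius. -/
lemma level_good [IsFiniteMeasure P] {K : Set (Ω →ₘ[P] B)} (hK : ConvexlyCompact K)
    (hb : ASBounded K) (ξ : Ω →ₘ[P] ℝ) :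
    SeqClosed {x ∈ K | Rr K x ≤ ξ} ∧ LConvex {x ∈ K | Rr K x ≤ ξ} := by
  have ball : ∀ x y : Ω →ₘ[P] B, nrm (x - y) ≤ ξ ↔ ∀ᵐ ω ∂P, ‖x ω - y ω‖ ≤ ξ ω := by
    intro x y
    rw [← AEEqFun.coeFn_le]
    constructor
    · intro h
      filter_upwards [h, nrm_sub_coe x y] with ω h1 h2
      rwa [h2] at h1
    · intro h
      filter_upwards [h, nrm_sub_coe x y] with ω h1 h2
      rwa [h2]
  constructor
  · intro x z hx hxz
    have hz : z ∈ K := hK.2.1 x z (fun n => (hx n).1) hxz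
    refine ⟨hz, (Rr_le_iff hK.1 hb hz ξ).2 fun y hy => (ball z y).2 ?_⟩
    exact (pw_closed hK.2.1 (fun ω b => ‖b - y ω‖ ≤ ξ ω)
      (fun ω => isClosed_le (by fun_prop) continuous_const) x z
      (fun n => ⟨(hx n).1, (ball _ _).1 ((Rr_le_iff hK.1 hb (hx n).1 ξ).1 (hx n).2 y hy)⟩) hxz).2
  · intro x hx z hz l h0 h1
    have hm := hK.2.2.1 x hx.1 z hz.1 l h0 h1
    refine ⟨hm, (Rr_le_iff hK.1 hb hm ξ).2 fun y hy => (ball _ y).2 ?_⟩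
    refine (pw_convex hK.2.2.1 (fun ω b => ‖b - y ω‖ ≤ ξ ω) (fun ω => ?_) x
      ⟨hx.1, (ball _ _).1 ((Rr_le_iff hK.1 hb hx.1 ξ).1 hx.2 y hy)⟩ z
      ⟨hz.1, (ball _ _).1 ((Rr_le_iff hK.1 hb hz.1 ξ).1 hz.2 y hy)⟩ l h0 h1).2
    have : {b | ‖b - y ω‖ ≤ ξ ω} = Metric.closedBall (y ω) (ξ ω) := by
      ext b; simp [dist_eq_norm]
    rw [this]
    exact convex_closedBall _ _

lemma Rr_dir [IsFiniteMeasure P] {K : Set (Ω →ₘ[P] B)} (hK : ConvexlyCompact K)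
    (hb : ASBounded K) {x y : Ω →ₘ[P] B} (hx : x ∈ K) (hy : y ∈ K) :
    ∃ z ∈ K, Rr K z ≤ Rr K x ∧ Rr K z ≤ Rr K y := by
  obtain ⟨z, hz, h⟩ := glue hK.2.2.1 hx hy {ω | Rr K x ω ≤ Rr K y ω}
    (measurableSet_le (Rr K x).measurable (Rr K y).measurable)
  have key : ∀ w ∈ K, ∀ᵐ ω ∂P, nrm (z - w) ω ≤ Rr K x ω ∧ nrm (z - w) ω ≤ Rr K y ω := by
    intro w hw
    have h1 := AEEqFun.coeFn_le.2 ((Rr_le_iff hK.1 hb hx _).1 le_rfl w hw)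
    have h2 := AEEqFun.coeFn_le.2 ((Rr_le_iff hK.1 hb hy _).1 le_rfl w hw)
    filter_upwards [h1, h2, h, nrm_sub_coe x w, nrm_sub_coe y w, nrm_sub_coe z w]
      with ω a1 a2 a3 a4 a5 a6
    rw [a4] at a1
    rw [a5] at a2
    rw [a6]
    by_cases hh : Rr K x ω ≤ Rr K y ω
    · rw [a3.1 hh]; exact ⟨a1, a1.trans hh⟩
    · rw [a3.2 hh]; exact ⟨a2.trans (not_le.1 hh).le, a2⟩
  refine ⟨z, hz, (Rr_le_iff hK.1 hb hz _).2 fun w hw => ?_,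
    (Rr_le_iff hK.1 hb hz _).2 fun w hw => ?_⟩
  · rw [← AEEqFun.coeFn_le]
    filter_upwards [key w hw] with ω hω using hω.1
  · rw [← AEEqFun.coeFn_le]
    filter_upwards [key w hw] with ω hω using hω.2

lemma exists_center [IsFiniteMeasure P] {K : Set (Ω →ₘ[P] B)} (hK : ConvexlyCompact K)
    (hb : ASBounded K) : ∃ x ∈ K, ∀ y ∈ K, Rr K x ≤ Rr K y := by
  let C : (Ω →ₘ[P] B) → Set (Ω →ₘ[P] B) := fun y => {x ∈ K | Rr K x ≤ Rr K y}
  obtain ⟨x, hx⟩ := hK.2.2.2 (C '' K) (by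
      rintro _ ⟨y, hy, rfl⟩
      exact ⟨⟨y, hy, le_rfl⟩, fun z hz => hz.1, level_good hK hb _⟩) (by
    intro S hS
    have : ∃ z ∈ K, ∀ s ∈ S, C z ⊆ s := by
      induction S using Finset.induction_on with
      | empty => exact ⟨_, hK.1.some_mem, by simp⟩
      | insert a S ha ih =>
        rw [Finset.coe_insert, insert_subset_iff] at hS
        obtain ⟨z, hz, hN⟩ := ih hS.2
        obtain ⟨y, hy, rfl⟩ := hS.1
        obtain ⟨w, hw, w1, w2⟩ := Rr_dir hK hb hz hy
        refine ⟨w, hw, fun s hs => ?_⟩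
        rcases Finset.mem_insert.1 hs with rfl | hs
        · exact fun t ht => ⟨ht.1, ht.2.trans w2⟩
        · exact fun t ht => hN s hs ⟨ht.1, ht.2.trans w1⟩
    obtain ⟨z, hz, hN⟩ := this
    exact ⟨z, fun s hs => hN s hs ⟨hz, le_rfl⟩⟩)
  have hx' : ∀ y ∈ K, x ∈ C y := fun y hy => hx _ ⟨y, hy, rfl⟩
  exact ⟨x, (hx' _ hK.1.some_mem).1, fun y hy => (hx' y hy).2⟩

lemma Cc_eq [IsFiniteMeasure P] {K : Set (Ω →ₘ[P] B)} (hK : ConvexlyCompact K)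
    (hb : ASBounded K) : ∃ x₀ ∈ K, Rr K x₀ = RrS K K ∧ Cc K K = {x ∈ K | Rr K x ≤ Rr K x₀} := by
  obtain ⟨x₀, h0, h1⟩ := exists_center hK hb
  have hglb : IsGLB ((fun x => Rr K x) '' K) (Rr K x₀) := by
    refine IsLeast.isGLB ⟨⟨x₀, h0, rfl⟩, ?_⟩
    rintro _ ⟨y, hy, rfl⟩
    exact h1 y hy
  have he : RrS K K = Rr K x₀ := by
    have hex : ∃ ξ, IsGLB ((fun x => Rr K x) '' K) ξ := ⟨_, hglb⟩
    unfold RrS linf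
    rw [dif_pos hex]
    exact hex.choose_spec.unique hglb
  refine ⟨x₀, h0, he.symm, ?_⟩
  ext x
  simp only [Cc, he, mem_ofPred_eq]
  constructor
  · rintro ⟨a, b⟩; exact ⟨a, b.le⟩
  · rintro ⟨a, b⟩; exact ⟨a, le_antisymm b (h1 x a)⟩

lemma Rr_iso {K : Set (Ω →ₘ[P] B)} {T : (Ω →ₘ[P] B) → (Ω →ₘ[P] B)} (hm : MapsTo T K K)
    (hs : SurjOn T K K) (hi : IsometricOn K T) {x : Ω →ₘ[P] B} (hx : x ∈ K) :
    Rr K (T x) = Rr K x := by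
  unfold Rr
  congr 1
  ext ξ
  constructor
  · rintro ⟨y, hy, rfl⟩
    obtain ⟨w, hw, rfl⟩ := hs hy
    exact ⟨w, hw, (hi x hx w hw).symm⟩
  · rintro ⟨y, hy, rfl⟩
    exact ⟨T y, hm hy, hi x hx y hy⟩

lemma nrm_le_zero {x y : Ω →ₘ[P] B} (h : nrm (x - y) ≤ 0) : x = y := by
  rw [← AEEqFun.coeFn_le] at h
  apply AEEqFun.ext
  filter_upwards [h, nrm_sub_coe x y, AEEqFun.coeFn_zero (μ := P) (α := Ω) (β := ℝ)]
    with ω h1 h2 h3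
  rw [h2, h3] at h1
  exact sub_eq_zero.1 (norm_le_zero_iff.1 h1)

lemma nrm_self (x : Ω →ₘ[P] B) : nrm (x - x) = 0 := by
  apply AEEqFun.ext
  filter_upwards [nrm_sub_coe x x, AEEqFun.coeFn_zero (μ := P) (α := Ω) (β := ℝ)] with ω h1 h2
  rw [h1, h2]; simp

/-- The closed convex sets which are left invariant by the family. -/
def Inv (𝒯 : Set ((Ω →ₘ[P] B) → (Ω →ₘ[P] B))) (K : Set (Ω →ₘ[P] B)) : Prop :=
  K.Nonempty ∧ SeqClosed K ∧ LConvex K ∧ ∀ T ∈ 𝒯, MapsTo T K K ∧ SurjOn T K K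

lemma Inv_Cc [IsFiniteMeasure P] {G K : Set (Ω →ₘ[P] B)} (hG : ConvexlyCompact G) (hKG : K ⊆ G)
    (hb : ASBounded K) {𝒯 : Set ((Ω →ₘ[P] B) → (Ω →ₘ[P] B))} (hK : Inv 𝒯 K)
    (hiso : ∀ T ∈ 𝒯, IsometricOn G T) : Inv 𝒯 (Cc K K) := by
  have hKc := sub_compact hG hKG hK.1 hK.2.1 hK.2.2.1
  obtain ⟨x₀, h0, h1, h2⟩ := Cc_eq hKc hb
  have h3 := level_good hKc hb (Rr K x₀)
  rw [← h2] at h3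
  refine ⟨⟨x₀, h0, h1⟩, h3.1, h3.2, fun T hT => ?_⟩
  obtain ⟨hm, hs⟩ := hK.2.2.2 T hT
  have hi : IsometricOn K T := fun x hx y hy => hiso T hT x (hKG hx) y (hKG hy)
  constructor
  · intro x hx
    exact ⟨hm hx.1, (Rr_iso hm hs hi hx.1).trans hx.2⟩
  · intro y hy
    obtain ⟨x, hx, rfl⟩ := hs hy.1
    exact ⟨x, ⟨hx, (Rr_iso hm hs hi hx).symm.trans hy.2⟩, rfl⟩

/-- A family (no commutativity assumed) of surjective isometric self-mappings of an
`L⁰`-convexly compact set with random normal structure has a common fixed point in the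
random Chebyshev center `C(G,G)`. -/
theorem common_fixed_point_of_surjective_isometric
    {Ω : Type*} [MeasurableSpace Ω] {P : Measure Ω} [IsProbabilityMeasure P]
    {B : Type*} [NormedAddCommGroup B] [NormedSpace ℝ B] [CompleteSpace B]
    (G : Set (Ω →ₘ[P] B)) (hG : ConvexlyCompact G) (hns : RandNormalStructure G)
    (𝒯 : Set ((Ω →ₘ[P] B) → (Ω →ₘ[P] B)))
    (hmaps : ∀ T ∈ 𝒯, Set.MapsTo T G G)
    (hsurj : ∀ T ∈ 𝒯, Set.SurjOn T G G)
    (hiso : ∀ T ∈ 𝒯, IsometricOn G T) :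
    ∃ x ∈ Cc G G, ∀ T ∈ 𝒯, T x = x := by
  have hb : ASBounded G := compact_bdd hG
  have hbs : ∀ K ⊆ G, ASBounded K := fun K hK => by
    obtain ⟨ξ, hξ⟩ := hb
    exact ⟨ξ, fun h hh => hξ h (hK hh)⟩
  have hGI : Inv 𝒯 G := ⟨hG.1, hG.2.1, hG.2.2.1, fun T hT => ⟨hmaps T hT, hsurj T hT⟩⟩
  have hCG : Cc G G ⊆ G := fun x hx => hx.1
  obtain ⟨K, hKC, hmin⟩ := zorn_superset_nonempty {K | K ⊆ G ∧ Inv 𝒯 K} (by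
    intro c hc hch hne
    obtain ⟨K₀, hK₀⟩ := hne
    refine ⟨⋂₀ c, ⟨(sInter_subset_of_mem hK₀).trans (hc hK₀).1, ?_, ?_, ?_, ?_⟩,
      fun s hs => sInter_subset_of_mem hs⟩
    · refine hG.2.2.2 c (fun C hC =>
        ⟨(hc hC).2.1, (hc hC).1, (hc hC).2.2.1, (hc hC).2.2.2.1⟩) ?_
      intro S hS
      have : ∃ z ∈ c, ∀ s ∈ S, z ⊆ s := by
        induction S using Finset.induction_on with
        | empty => exact ⟨_, hK₀, by simp⟩
        | insert a S ha ih =>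
          rw [Finset.coe_insert, insert_subset_iff] at hS
          obtain ⟨z, hz, hN⟩ := ih hS.2
          rcases hch.total hz hS.1 with h | h
          · refine ⟨z, hz, fun s hs => ?_⟩
            rcases Finset.mem_insert.1 hs with rfl | hs
            · exact h
            · exact hN s hs
          · refine ⟨a, hS.1, fun s hs => ?_⟩
            rcases Finset.mem_insert.1 hs with rfl | hs
            · exact subset_rfl
            · exact h.trans (hN s hs)
      obtain ⟨z, hz, hN⟩ := this
      obtain ⟨x, hx⟩ := (hc hz).2.1
      exact ⟨x, fun s hs => hN s hs hx⟩
    · exact fun x y hx hxy C hC => (hc hC).2.2.1 x y (fun n => hx n C hC) hxy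
    · exact fun x hx y hy l h0 h1 C hC => (hc hC).2.2.2.1 x (hx C hC) y (hy C hC) l h0 h1
    · intro T hT
      constructor
      · exact fun x hx C hC => ((hc hC).2.2.2.2 T hT).1 (hx C hC)
      · intro y hy
        obtain ⟨x, hx, hxy⟩ := ((hc hK₀).2.2.2.2 T hT).2 (hy K₀ hK₀)
        refine ⟨x, fun C hC => ?_, hxy⟩
        obtain ⟨w, hw, hwy⟩ := ((hc hC).2.2.2.2 T hT).2 (hy C hC)
        have h := hiso T hT x ((hc hK₀).1 hx) w ((hc hC).1 hw)
        rw [hxy, hwy, nrm_self] at h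
        have := nrm_le_zero h.symm.le
        rwa [this])
    (Cc G G) ⟨hCG, Inv_Cc hG subset_rfl hb hGI hiso⟩
  obtain ⟨hKG, hKI⟩ := hmin.prop
  have hbK := hbs K hKG
  have hall : K ⊆ Cc K K := hmin.le_of_le
    (show Cc K K ∈ {K | K ⊆ G ∧ Inv 𝒯 K} from
      ⟨fun x hx => hKG hx.1, Inv_Cc hG hKG hbK hKI hiso⟩) (fun x hx => hx.1)
  have hD : Dd K = 0 := by
    by_contra hne
    obtain ⟨z, hz, hlt⟩ := hns K hKG hKI.1 hbK hKI.2.1 hKI.2.2.1 hne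
    have hle : Dd K ≤ Rr K z := by
      refine (Dd_lub hKI.1 hbK).2 ?_
      rintro _ ⟨x, hx, y, hy, rfl⟩
      rw [(hall hz).2, ← (hall hx).2]
      exact (Rr_le_iff hKI.1 hbK hx _).1 le_rfl y hy
    have h0 : 0 ≤ Dd K := by
      refine (Dd_lub hKI.1 hbK).1 ?_
      exact ⟨z, hz, z, hz, (nrm_self z).symm⟩
    apply hne
    rw [← AEEqFun.coeFn_le] at hle h0
    apply AEEqFun.ext
    filter_upwards [hle, h0, hlt, AEEqFun.coeFn_zero (μ := P) (α := Ω) (β := ℝ)]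
      with ω h1 h2 h3 h4
    rw [h4] at h2 ⊢
    by_contra h5
    exact absurd (h3 (lt_of_le_of_ne h2 (Ne.symm h5))) (not_lt.2 h1)
  obtain ⟨x, hx⟩ := id hKI.1
  refine ⟨x, hKC hx, fun T hT => ?_⟩
  have hT' := (hKI.2.2.2 T hT).1 hx
  apply nrm_le_zero
  rw [← hD]
  have hd := (Dd_lub hKI.1 hbK).1
  refine hd ?_
  exact ⟨T x, hT', x, hx, rfl⟩

end RNM
end
end

section
/- Let G be an L⁰-convexly compact subset of L⁰(𝓕,B) and T : G → G a surjective isometric mapping. Then T maps the random Chebyshev center onto itself: T(C(G,G)) = C(G,G). -/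
open MeasureTheory Set Filter Function
open scoped Classical

noncomputable section

namespace RNM


variable {Ω : Type*} [MeasurableSpace Ω] {P : Measure Ω}
variable {B : Type*} [NormedAddCommGroup B] [NormedSpace ℝ B]

/-- A surjective isometric self-mapping of an `L⁰`-convexly compact set maps the random
Chebyshev center onto itself. -/
theorem image_randomChebCenter_of_surjective_isometric
    {Ω : Type*} [MeasurableSpace Ω] {P : Measure Ω} [IsProbabilityMeasure P]
    {B : Type*} [NormedAddCommGroup B] [NormedSpace ℝ B] [CompleteSpace B]
    (G : Set (Ω →ₘ[P] B)) (hG : ConvexlyCompact G)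
    (T : (Ω →ₘ[P] B) → (Ω →ₘ[P] B)) (hmaps : Set.MapsTo T G G)
    (hsurj : Set.SurjOn T G G) (hiso : IsometricOn G T) :
    T '' Cc G G = Cc G G := by
  have key : ∀ x ∈ G, Rr G (T x) = Rr G x := by
    intro x hx
    unfold Rr
    congr 1
    ext ξ
    constructor
    · rintro ⟨y, hy, rfl⟩
      obtain ⟨z, hz, rfl⟩ := hsurj hy
      exact ⟨z, hz, (hiso x hx z hz).symm⟩
    · rintro ⟨z, hz, rfl⟩
      exact ⟨T z, hmaps hz, hiso x hx z hz⟩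
  ext y
  constructor
  · rintro ⟨x, ⟨hx, hxe⟩, rfl⟩
    exact ⟨hmaps hx, (key x hx).trans hxe⟩
  · rintro ⟨hy, hye⟩
    obtain ⟨x, hx, rfl⟩ := hsurj hy
    exact ⟨x, ⟨hx, (key x hx).symm.trans hye⟩, rfl⟩

end RNM
end
end

section
/- Let B be a strictly convex real Banach space, G a nonempty L⁰-convex subset of L⁰(𝓕,B), and T : G → L⁰(𝓕,B) an isometric mapping (‖Tx − Ty‖ = ‖x − y‖ in L⁰(𝓕) for all x, y ∈ G). Then T is L⁰-affine: T(λx + (1−λ)y) = λT(x) + (1−λ)T(y) for all x, y ∈ G and all λ ∈ L⁰(𝓕) with 0 ≤ λ ≤ 1. -/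
open MeasureTheory Set Filter Function
open scoped Classical

noncomputable section

namespace RNM


variable {Ω : Type*} [MeasurableSpace Ω] {P : Measure Ω}
variable {B : Type*} [NormedAddCommGroup B] [NormedSpace ℝ B]

/-- If `B` is a strictly convex Banach space, every isometric mapping from an `L⁰`-convex
subset `G` of `L⁰(𝓕,B)` into `L⁰(𝓕,B)` is `L⁰`-affine. -/
theorem isometric_is_L0_affine_of_strictConvex
    {Ω : Type*} [MeasurableSpace Ω] {P : Measure Ω} [IsProbabilityMeasure P]
    {B : Type*} [NormedAddCommGroup B] [NormedSpace ℝ B] [CompleteSpace B]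
    [StrictConvexSpace ℝ B]
    (G : Set (Ω →ₘ[P] B)) (hGne : G.Nonempty) (hGcv : LConvex G)
    (T : (Ω →ₘ[P] B) → (Ω →ₘ[P] B))
    (hiso : ∀ x ∈ G, ∀ y ∈ G, nrm (T x - T y) = nrm (x - y)) :
    ∀ x ∈ G, ∀ y ∈ G, ∀ l : Ω →ₘ[P] ℝ, 0 ≤ l → l ≤ 1 →
      T (msmul l x + msmul (1 - l) y) = msmul l (T x) + msmul (1 - l) (T y) := by
  intro x hx y hy l hl0 hl1
  have hz := hGcv x hx y hy l hl0 hl1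
  have h1 := hiso y hy _ hz
  have h2 := hiso _ hz x hx
  have h3 := hiso y hy x hx
  have nae : ∀ u : Ω →ₘ[P] B, ∀ᵐ ω ∂P, nrm u ω = ‖u ω‖ := fun u =>
    AEEqFun.coeFn_comp norm continuous_norm u
  have sae : ∀ (k : Ω →ₘ[P] ℝ) (u : Ω →ₘ[P] B), ∀ᵐ ω ∂P, msmul k u ω = k ω • u ω :=
    fun k u => AEEqFun.coeFn_comp₂ _ _ k u
  have dae : ∀ u v : Ω →ₘ[P] B, ∀ᵐ ω ∂P, nrm (u - v) ω = ‖u ω - v ω‖ := by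
    intro u v
    filter_upwards [nae (u - v), AEEqFun.coeFn_sub u v] with ω a b
    rw [a, b, Pi.sub_apply]
  have cae : ∀ u v : Ω →ₘ[P] B, ∀ᵐ ω ∂P,
      (msmul l u + msmul (1 - l) v : Ω →ₘ[P] B) ω = l ω • u ω + (1 - l ω) • v ω := by
    intro u v
    filter_upwards [sae l u, sae (1 - l) v, AEEqFun.coeFn_sub (1 : Ω →ₘ[P] ℝ) l,
      AEEqFun.coeFn_one (α := Ω) (β := ℝ) (μ := P),
      AEEqFun.coeFn_add (msmul l u) (msmul (1 - l) v)] with ω a b c d e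
    rw [e, Pi.add_apply, a, b, c, Pi.sub_apply, d, Pi.one_apply]
  have l0 : ∀ᵐ ω ∂P, 0 ≤ l ω := by
    filter_upwards [AEEqFun.coeFn_le.mpr hl0,
      AEEqFun.coeFn_zero (α := Ω) (β := ℝ) (μ := P)] with ω a b
    rw [b] at a
    exact a
  have l1 : ∀ᵐ ω ∂P, l ω ≤ 1 := by
    filter_upwards [AEEqFun.coeFn_le.mpr hl1,
      AEEqFun.coeFn_one (α := Ω) (β := ℝ) (μ := P)] with ω a b
    rw [b] at a
    exact a
  have hc := cae x y
  set z := msmul l x + msmul (1 - l) y with hzdef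
  apply AEEqFun.ext
  have d1 := dae (T y) (T z)
  have d2 := dae (T z) (T x)
  have d3 := dae (T y) (T x)
  rw [h1] at d1
  rw [h2] at d2
  rw [h3] at d3
  filter_upwards [d1, d2, d3, dae y z, dae z x, dae y x, hc, cae (T x) (T y), l0, l1]
    with ω d1 d2 d3 e1 e2 e3 hc hT l0 l1
  rw [hT]
  rw [e1] at d1
  rw [e2] at d2
  rw [e3] at d3
  have k1 : dist (T y ω) (T z ω) = l ω * dist (T y ω) (T x ω) := by
    rw [dist_eq_norm, dist_eq_norm, ← d1, ← d3, hc]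
    have : y ω - (l ω • x ω + (1 - l ω) • y ω) = l ω • (y ω - x ω) := by module
    rw [this, norm_smul, Real.norm_of_nonneg l0]
  have k2 : dist (T z ω) (T x ω) = (1 - l ω) * dist (T y ω) (T x ω) := by
    rw [dist_eq_norm, dist_eq_norm, ← d2, ← d3, hc]
    have : (l ω • x ω + (1 - l ω) • y ω) - x ω = (1 - l ω) • (y ω - x ω) := by module
    rw [this, norm_smul, Real.norm_of_nonneg (sub_nonneg.mpr l1)]
  rw [eq_lineMap_of_dist_eq_mul_of_dist_eq_mul k1 k2, AffineMap.lineMap_apply_module]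
  abel

end RNM
end
end

section
/- Let B be a uniformly convex real Banach space, G a nonempty a.s. bounded closed L⁰-convex subset of L⁰(𝓕,B), and T : G → G an isometric mapping. Then R(T(G), T(G)) = R(G, G) and C(T(G), T(G)) = T(C(G, G)). -/
open MeasureTheory Set Filter Function
open scoped Classical

noncomputable section

namespace RNM


variable {Ω : Type*} [MeasurableSpace Ω] {P : Measure Ω}
variable {B : Type*} [NormedAddCommGroup B] [NormedSpace ℝ B]

/-- If `B` is a uniformly convex Banach space, `G` a nonempty a.s. bounded closed
`L⁰`-convex subset of `L⁰(𝓕,B)` and `T : G → G` isometric, then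
`R(T(G),T(G)) = R(G,G)` and `C(T(G),T(G)) = T(C(G,G))`. -/
theorem chebRadius_center_of_isometric_uniformConvex
    {Ω : Type*} [MeasurableSpace Ω] {P : Measure Ω} [IsProbabilityMeasure P]
    {B : Type*} [NormedAddCommGroup B] [NormedSpace ℝ B] [CompleteSpace B]
    [UniformConvexSpace B]
    (G : Set (Ω →ₘ[P] B)) (hGne : G.Nonempty) (hGbd : ASBounded G)
    (hGcl : SeqClosed G) (hGcv : LConvex G)
    (T : (Ω →ₘ[P] B) → (Ω →ₘ[P] B)) (hmaps : Set.MapsTo T G G)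
    (hiso : IsometricOn G T) :
    RrS (T '' G) (T '' G) = RrS G G ∧ Cc (T '' G) (T '' G) = T '' Cc G G := by
  have hR : ∀ x ∈ G, Rr (T '' G) (T x) = Rr G x := by
    intro x hx
    have h : (fun y => nrm (T x - y)) '' (T '' G) = (fun y => nrm (x - y)) '' G := by
      rw [Set.image_image]
      exact Set.image_congr fun y hy => hiso x hx y hy
    unfold Rr
    rw [h]
  have hS : RrS (T '' G) (T '' G) = RrS G G := by
    have h : (fun x => Rr (T '' G) x) '' (T '' G) = (fun x => Rr G x) '' G := by
      rw [Set.image_image]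
      exact Set.image_congr hR
    unfold RrS
    rw [h]
  refine ⟨hS, ?_⟩
  ext z
  constructor
  · rintro ⟨⟨x, hx, rfl⟩, hz⟩
    exact ⟨x, ⟨hx, by rw [← hR x hx, hz, hS]⟩, rfl⟩
  · rintro ⟨x, ⟨hx, hz⟩, rfl⟩
    exact ⟨⟨x, hx, rfl⟩, by rw [hR x hx, hz, hS]⟩

end RNM
end
end
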